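/- Let φ = p̃/p be a bidegree (m,n) rational inner function on 𝔻² and let α ∈ 𝕋 be generic for φ. Then for each j = 1,…,n, the Clark weight W_j^α(ζ) = |∂φ/∂z₂(ζ, g_j^α(ζ))|^{-1} belongs to L¹(𝕋, m) and satisfies W_j^α(ζ) = |p(ζ, g_j^α(ζ))| / |∂p̃/∂z₂(ζ, g_j^α(ζ)) − α ∂p/∂z₂(ζ, g_j^α(ζ))| for ζ ∈ 𝕋. -/

import Mathlib

open MeasureTheory Complex Filter Topology

noncomputable section

/-- The open unit bidisk `𝔻²` in `ℂ²`. -/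
def bidisk : Set (ℂ × ℂ) := {z | ‖z.1‖ < 1 ∧ ‖z.2‖ < 1}

/-- The closed bidisk. -/
def closedBidisk : Set (ℂ × ℂ) := {z | ‖z.1‖ ≤ 1 ∧ ‖z.2‖ ≤ 1}

/-- The distinguished boundary `𝕋²` of the bidisk. -/
def torus2 : Set (ℂ × ℂ) := {z | ‖z.1‖ = 1 ∧ ‖z.2‖ = 1}

/-- Evaluation of a two-variable polynomial at a point of `ℂ²`. -/
def ev (p : MvPolynomial (Fin 2) ℂ) (z : ℂ × ℂ) : ℂ :=
  MvPolynomial.eval ![z.1, z.2] p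

/-- The rational function `φ = p̃/p`. -/
def rif (p pt : MvPolynomial (Fin 2) ℂ) (z : ℂ × ℂ) : ℂ := ev pt z / ev p z

/-- The partial derivative `∂φ/∂z₁` of `φ = p̃/p`, via the quotient rule. -/
def dphi1 (p pt : MvPolynomial (Fin 2) ℂ) (z : ℂ × ℂ) : ℂ :=
  (ev (MvPolynomial.pderiv 0 pt) z * ev p z - ev pt z * ev (MvPolynomial.pderiv 0 p) z) /
    (ev p z) ^ 2

/-- The partial derivative `∂φ/∂z₂` of `φ = p̃/p`, via the quotient rule. -/
def dphi2 (p pt : MvPolynomial (Fin 2) ℂ) (z : ℂ × ℂ) : ℂ :=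
  (ev (MvPolynomial.pderiv 1 pt) z * ev p z - ev pt z * ev (MvPolynomial.pderiv 1 p) z) /
    (ev p z) ^ 2

/-- `pt` is the reflection `p̃(z₁,z₂) = z₁^m z₂^n conj(p(1/conj z₁, 1/conj z₂))` of `p`
at bidegree `(m,n)`. -/
def IsReflection2 (m n : ℕ) (p pt : MvPolynomial (Fin 2) ℂ) : Prop :=
  ∀ z : ℂ × ℂ, z.1 ≠ 0 → z.2 ≠ 0 →
    ev pt z = z.1 ^ m * z.2 ^ n *
      (starRingEnd ℂ) (ev p (((starRingEnd ℂ) z.1)⁻¹, ((starRingEnd ℂ) z.2)⁻¹))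

/-- The data of a bidegree `(m,n)` rational inner function `φ = p̃/p` on the bidisk
(with `m, n ≥ 1`):  `p` has degree `m` in `z₁` and `n` in `z₂`, is zero-free on `𝔻²`,
and has no common factor with its reflection `p̃`. -/
structure IsRIF2 (m n : ℕ) (p pt : MvPolynomial (Fin 2) ℂ) : Prop where
  hm : 1 ≤ m
  hn : 1 ≤ n
  deg1 : MvPolynomial.degreeOf 0 p = m
  deg2 : MvPolynomial.degreeOf 1 p = n
  stable : ∀ z ∈ bidisk, ev p z ≠ 0
  coprime : ∀ r : MvPolynomial (Fin 2) ℂ, r ∣ p → r ∣ pt → IsUnit r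
  reflection : IsReflection2 m n p pt

/-- The unimodular level set `C_α(φ)`, the closure of the set of points of `𝕋²` where
the radial limit of `φ` equals `α`. -/
def levelSet2 (p pt : MvPolynomial (Fin 2) ℂ) (α : ℂ) : Set (ℂ × ℂ) :=
  closure {ζ | ζ ∈ torus2 ∧
    Tendsto (fun r : ℝ => rif p pt ((r : ℂ) * ζ.1, (r : ℂ) * ζ.2))
      (𝓝[<] (1 : ℝ)) (𝓝 α)}

/-- `α` is an exceptional value for `φ = p̃/p`: some horizontal or vertical line of `𝕋²`
is contained in `C_α(φ)`. -/
def IsExceptional (p pt : MvPolynomial (Fin 2) ℂ) (α : ℂ) : Prop :=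
  ∃ τ : ℂ, ‖τ‖ = 1 ∧
    ({ζ : ℂ × ℂ | ζ.1 = τ ∧ ‖ζ.2‖ = 1} ⊆ levelSet2 p pt α ∨
     {ζ : ℂ × ℂ | ‖ζ.1‖ = 1 ∧ ζ.2 = τ} ⊆ levelSet2 p pt α)

/-- `α` is a generic value for `φ = p̃/p`. -/
def IsGenericValue (p pt : MvPolynomial (Fin 2) ℂ) (α : ℂ) : Prop :=
  ¬ IsExceptional p pt α

/-- Normalized Lebesgue (arclength) measure on the unit circle, as a measure on `ℂ`. -/
def mCircle : Measure ℂ :=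
  (ENNReal.ofReal (2 * Real.pi))⁻¹ •
    Measure.map (fun θ : ℝ => Complex.exp ((θ : ℂ) * Complex.I))
      (MeasureTheory.volume.restrict (Set.Ico 0 (2 * Real.pi)))

/-- The two-variable product Poisson kernel. -/
def poisson2 (z ζ : ℂ × ℂ) : ℝ :=
  ((1 - ‖z.1‖ ^ 2) / ‖ζ.1 - z.1‖ ^ 2) * ((1 - ‖z.2‖ ^ 2) / ‖ζ.2 - z.2‖ ^ 2)

/-- `σ` is the Clark measure of `φ = p̃/p` at parameter `α`: a positive Borel measure
on `𝕋²` whose Poisson integral is `(1-|φ(z)|²)/|α-φ(z)|²`. -/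
def IsClarkMeasure2 (p pt : MvPolynomial (Fin 2) ℂ) (α : ℂ) (σ : Measure (ℂ × ℂ)) : Prop :=
  σ torus2ᶜ = 0 ∧
  ∀ z ∈ bidisk,
    ∫⁻ ζ, ENNReal.ofReal (poisson2 z ζ) ∂σ =
      ENNReal.ofReal ((1 - ‖rif p pt z‖ ^ 2) / ‖α - rif p pt z‖ ^ 2)

/-- `g₁, …, g_n : 𝕋 → 𝕋` are functions on the circle, analytic except possibly at one
base point `τ₀ ∈ 𝕋`. -/
def IsGraphFamily (n : ℕ) (g : Fin n → ℂ → ℂ) : Prop :=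
  (∀ j, ∀ ζ : ℂ, ‖ζ‖ = 1 → ‖g j ζ‖ = 1) ∧
  ∃ τ₀ : ℂ, ‖τ₀‖ = 1 ∧ ∀ j, ∀ θ : ℝ,
    Complex.exp ((θ : ℂ) * Complex.I) ≠ τ₀ →
      AnalyticAt ℝ (fun t : ℝ => g j (Complex.exp ((t : ℂ) * Complex.I))) θ

/-- The union of the graphs `{(ζ, g_j(ζ)) : ζ ∈ 𝕋}`. -/
def graphUnion (n : ℕ) (g : Fin n → ℂ → ℂ) : Set (ℂ × ℂ) :=
  ⋃ j, {w : ℂ × ℂ | ‖w.1‖ = 1 ∧ w.2 = g j w.1}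

/-- The vertical line `{ζ ∈ 𝕋² : ζ₁ = τ}`. -/
def vLine (τ : ℂ) : Set (ℂ × ℂ) := {w : ℂ × ℂ | w.1 = τ ∧ ‖w.2‖ = 1}

theorem ev_cont (p : MvPolynomial (Fin 2) ℂ) : Continuous (ev p) := by
  unfold ev
  refine (MvPolynomial.continuous_eval p).comp ?_
  refine continuous_pi fun i => ?_
  fin_cases i
  · exact continuous_fst
  · exact continuous_snd

theorem ev_diff (p : MvPolynomial (Fin 2) ℂ) : Differentiable ℂ (ev p) := by
  unfold ev
  induction p using MvPolynomial.induction_on with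
  | C a => simp
  | add p q hp hq => simp only [map_add]; exact hp.add hq
  | mul_X p i hp =>
    simp only [map_mul, MvPolynomial.eval_X]
    refine hp.mul ?_
    fin_cases i
    · exact differentiable_fst
    · exact differentiable_snd

theorem ev_hasDeriv (p : MvPolynomial (Fin 2) ℂ) (z w : ℂ) :
    HasDerivAt (fun w => ev p (z, w)) (ev (MvPolynomial.pderiv 1 p) (z, w)) w := by
  unfold ev
  induction p using MvPolynomial.induction_on with
  | C a => simpa using hasDerivAt_const w a
  | add p q hp hq => simp only [map_add]; exact hp.add hq
  | mul_X p i hp =>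
    simp only [Derivation.leibniz, map_add, map_mul, MvPolynomial.eval_X, smul_eq_mul]
    fin_cases i
    · simpa [MvPolynomial.pderiv_X, mul_comm] using hp.mul_const z
    · simpa [MvPolynomial.pderiv_X, mul_comm, add_comm] using hp.fun_mul (hasDerivAt_id' w)

theorem max_disc (f h : ℂ → ℂ) (hf : Differentiable ℂ f) (hh : Differentiable ℂ h)
    (h0 : ∀ z, ‖z‖ ≤ 1 → h z ≠ 0) (hb : ∀ z, ‖z‖ = 1 → ‖f z‖ ≤ ‖h z‖) (z : ℂ) (hz : ‖z‖ ≤ 1) :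
    ‖f z‖ ≤ ‖h z‖ := by
  have hd : DifferentiableOn ℂ (fun z => f z / h z) (Metric.closedBall 0 1) := by
    intro x hx
    exact ((hf x).div (hh x) (h0 x (by simpa using hx))).differentiableWithinAt
  have := Complex.norm_le_of_forall_mem_frontier_norm_le (U := Metric.ball (0:ℂ) 1)
    (f := fun z => f z / h z) (C := 1) Metric.isBounded_ball
    ⟨hd.mono Metric.ball_subset_closedBall, by
      rw [closure_ball _ one_ne_zero]; exact hd.continuousOn⟩
    (by
      intro x hx
      rw [frontier_ball _ one_ne_zero] at hx
      have hx' : ‖x‖ = 1 := by simpa using hx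
      rw [norm_div]
      exact div_le_one_of_le₀ (hb x hx') (norm_nonneg _))
    (z := z) (by rw [closure_ball _ one_ne_zero]; simpa using hz)
  rw [norm_div] at this
  exact (div_le_one (norm_pos_iff.2 (h0 z hz))).1 this

theorem pt_le_r {m n : ℕ} {p pt : MvPolynomial (Fin 2) ℂ} (h : IsRIF2 m n p pt)
    (r : ℝ) (hr0 : 0 < r) (hr : r < 1) (z : ℂ × ℂ) (hz : z ∈ closedBidisk) :
    ‖(r : ℂ) ^ (m + n) * ev pt (z.1 / r, z.2 / r)‖ ≤ ‖ev p (r * z.1, r * z.2)‖ := by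
  obtain ⟨z1, z2⟩ := z
  obtain ⟨h1, h2⟩ := hz
  simp only at h1 h2 ⊢
  have hrc : (r : ℂ) ≠ 0 := by exact_mod_cast hr0.ne'
  have small : ∀ x : ℂ, ‖x‖ ≤ 1 → ‖(r : ℂ) * x‖ < 1 := by
    intro x hx
    rw [norm_mul, Complex.norm_real, Real.norm_of_nonneg hr0.le]
    nlinarith [norm_nonneg x]
  have nz : ∀ x y : ℂ, ‖x‖ ≤ 1 → ‖y‖ ≤ 1 → ev p (r * x, r * y) ≠ 0 := fun x y hx hy =>
    h.stable _ ⟨small x hx, small y hy⟩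
  have tor : ∀ x y : ℂ, ‖x‖ = 1 → ‖y‖ = 1 →
      ‖(r : ℂ) ^ (m + n) * ev pt (x / r, y / r)‖ ≤ ‖ev p (r * x, r * y)‖ := by
    intro x y hx hy
    have hx0 : x ≠ 0 := by rintro rfl; simp at hx
    have hy0 : y ≠ 0 := by rintro rfl; simp at hy
    have inv : ∀ x : ℂ, ‖x‖ = 1 → ((starRingEnd ℂ) (x / r))⁻¹ = r * x := by
      intro x hx
      rw [map_div₀, Complex.conj_ofReal, ← Complex.inv_eq_conj hx, inv_div, div_inv_eq_mul]
    rw [h.reflection (x / r, y / r) (div_ne_zero hx0 hrc) (div_ne_zero hy0 hrc)]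
    simp only [inv x hx, inv y hy]
    simp only [norm_mul, norm_pow, norm_div, hx, hy, RCLike.norm_conj, Complex.norm_real,
      Real.norm_of_nonneg hr0.le]
    apply le_of_eq
    have hr1 : r ^ m * r⁻¹ ^ m = 1 := by rw [← mul_pow, mul_inv_cancel₀ hr0.ne', one_pow]
    have hr2 : r ^ n * r⁻¹ ^ n = 1 := by rw [← mul_pow, mul_inv_cancel₀ hr0.ne', one_pow]
    rw [one_div, pow_add]
    linear_combination ‖ev p (r * x, r * y)‖ * (r ^ n * r⁻¹ ^ n * hr1 + hr2)
  have s1 : ∀ x y : ℂ, ‖x‖ ≤ 1 → ‖y‖ = 1 →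
      ‖(r : ℂ) ^ (m + n) * ev pt (x / r, y / r)‖ ≤ ‖ev p (r * x, r * y)‖ := by
    intro x y hx hy
    refine max_disc (fun x => (r : ℂ) ^ (m + n) * ev pt (x / r, y / r))
      (fun x => ev p (r * x, r * y)) ?_ ?_ (fun x hx => nz x y hx hy.le)
      (fun x hx => tor x y hx hy) x hx
    · exact ((ev_diff pt).comp (by fun_prop)).const_mul _
    · exact (ev_diff p).comp (by fun_prop)
  refine max_disc (fun y => (r : ℂ) ^ (m + n) * ev pt (z1 / r, y / r))
      (fun y => ev p (r * z1, r * y)) ?_ ?_ (fun y hy => nz z1 y h1 hy)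
      (fun y hy => s1 z1 y h1 hy) z2 h2
  · exact ((ev_diff pt).comp (by fun_prop)).const_mul _
  · exact (ev_diff p).comp (by fun_prop)

theorem pt_le {m n : ℕ} {p pt : MvPolynomial (Fin 2) ℂ} (h : IsRIF2 m n p pt)
    (z : ℂ × ℂ) (hz : z ∈ closedBidisk) : ‖ev pt z‖ ≤ ‖ev p z‖ := by
  have e : ∀ᶠ r : ℝ in 𝓝[<] (1:ℝ),
      ‖(r : ℂ) ^ (m + n) * ev pt (z.1 / r, z.2 / r)‖ ≤ ‖ev p (r * z.1, r * z.2)‖ := by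
    have : Set.Ioo (0:ℝ) 1 ∈ 𝓝[<] (1:ℝ) := Ioo_mem_nhdsLT one_pos
    filter_upwards [this] with r hr
    exact pt_le_r h r hr.1 hr.2 z hz
  have c1 : ContinuousAt (fun r : ℝ => ‖(r : ℂ) ^ (m + n) * ev pt (z.1 / r, z.2 / r)‖) 1 := by
    have : ContinuousAt (fun r : ℝ => ev pt (z.1 / r, z.2 / r)) 1 := by
      refine (ev_cont pt).continuousAt.comp ?_
      have hc : ContinuousAt (fun r : ℝ => (r : ℂ)) 1 := Complex.continuous_ofReal.continuousAt
      exact (continuousAt_const.div hc (by simp)).prodMk (continuousAt_const.div hc (by simp))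
    exact ((Complex.continuous_ofReal.continuousAt.pow _).mul this).norm
  have c2 : ContinuousAt (fun r : ℝ => ‖ev p (r * z.1, r * z.2)‖) 1 := by
    have : Continuous (fun r : ℝ => ‖ev p (r * z.1, r * z.2)‖) :=
      ((ev_cont p).comp (by fun_prop)).norm
    exact this.continuousAt
  have := le_of_tendsto_of_tendsto (c1.tendsto.mono_left nhdsWithin_le_nhds)
    (c2.tendsto.mono_left nhdsWithin_le_nhds) e
  simpa using this

theorem pt_lt {m n : ℕ} {p pt : MvPolynomial (Fin 2) ℂ} (h : IsRIF2 m n p pt)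
    (z : ℂ × ℂ) (hz : z ∈ bidisk) : ‖ev pt z‖ < ‖ev p z‖ := by
  have hsub : ∀ z ∈ bidisk, z ∈ closedBidisk := fun z hz => ⟨hz.1.le, hz.2.le⟩
  refine lt_of_le_of_ne (pt_le h z (hsub z hz)) fun heq => ?_
  have hbd : bidisk = Metric.ball (0:ℂ) 1 ×ˢ Metric.ball (0:ℂ) 1 := by
    ext x; simp [bidisk]
  have hd : DifferentiableOn ℂ (fun z => ev pt z / ev p z) bidisk := fun x hx => by
    simp only [div_eq_mul_inv]
    exact ((ev_diff pt x).fun_mul ((ev_diff p x).fun_inv (h.stable x hx))).differentiableWithinAt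
  have key := Complex.eqOn_of_isPreconnected_of_isMaxOn_norm (U := bidisk) (c := z)
    (f := fun z => ev pt z / ev p z)
    (by rw [hbd]; exact ((convex_ball _ _).prod (convex_ball _ _)).isPreconnected)
    (by rw [hbd]; exact Metric.isOpen_ball.prod Metric.isOpen_ball) hd hz
    (by
      intro x hx
      simp only [Function.comp, Set.mem_ofPred_eq, norm_div, heq]
      rw [div_self (norm_ne_zero_iff.2 (h.stable z hz))]
      exact div_le_one_of_le₀ (pt_le h x (hsub x hx)) (norm_nonneg _))
  set c := ev pt z / ev p z
  have hpt : pt = MvPolynomial.C c * p := by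
    refine MvPolynomial.funext_set (fun _ => Metric.ball (0:ℂ) 1) ?_ ?_
    · intro i
      exact infinite_of_mem_nhds (0:ℂ) (Metric.ball_mem_nhds _ one_pos)
    · intro x hx
      have hx0 := hx 0 trivial
      have hx1 := hx 1 trivial
      have hxb : (x 0, x 1) ∈ bidisk := by
        constructor
        · simpa using hx0
        · simpa using hx1
      have := key hxb
      simp only [Function.const] at this
      rw [div_eq_iff (h.stable _ hxb)] at this
      have hv : ![x 0, x 1] = x := by ext i; fin_cases i <;> rfl
      simpa [ev, hv] using this
  have hu := h.coprime p dvd_rfl ⟨MvPolynomial.C c, by rw [hpt, mul_comm]⟩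
  obtain ⟨u, hu, rfl⟩ := MvPolynomial.isUnit_iff_eq_C_of_isReduced.1 hu
  have := h.deg1
  rw [MvPolynomial.degreeOf_C] at this
  have := h.hm
  omega

theorem nsq_c (a : ℂ) : ((‖a‖ ^ 2 : ℝ) : ℂ) = a * (starRingEnd ℂ) a := by
  rw [Complex.mul_conj, Complex.normSq_eq_norm_sq]

theorem sp_ident (a b c d : ℂ) :
    ‖(starRingEnd ℂ) a * c - (starRingEnd ℂ) b * d‖ ^ 2 - ‖b * c - a * d‖ ^ 2 =
      (‖a‖ ^ 2 - ‖b‖ ^ 2) * (‖c‖ ^ 2 - ‖d‖ ^ 2) := by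
  apply Complex.ofReal_injective
  push_cast [-Complex.ofReal_pow]
  simp only [nsq_c, map_sub, map_mul, Complex.conj_conj]
  ring

/-- Schwarz-Pick in polynomial form. -/
theorem sp_slice (f h : ℂ → ℂ) (hf : Differentiable ℂ f) (hh : Differentiable ℂ h)
    (hlt : ∀ w, ‖w‖ < 1 → ‖f w‖ < ‖h w‖) (w : ℂ) (hw : ‖w‖ < 1) :
    ‖(starRingEnd ℂ) (h 0) * h w - (starRingEnd ℂ) (f 0) * f w‖ ^ 2 * (1 - ‖w‖ ^ 2) ≤
      (‖h 0‖ ^ 2 - ‖f 0‖ ^ 2) * (‖h w‖ ^ 2 - ‖f w‖ ^ 2) := by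
  have h00 := hlt 0 (by simp)
  have pos : ∀ w, ‖w‖ < 1 →
      0 < (‖h 0‖ ^ 2 - ‖f 0‖ ^ 2) * (‖h w‖ ^ 2 - ‖f w‖ ^ 2) := by
    intro w hw
    have := hlt w hw
    apply mul_pos <;> nlinarith [norm_nonneg (f w), norm_nonneg (f 0)]
  have dpos : ∀ w, ‖w‖ < 1 → ‖f 0 * h w - h 0 * f w‖ ^ 2 <
      ‖(starRingEnd ℂ) (h 0) * h w - (starRingEnd ℂ) (f 0) * f w‖ ^ 2 := by
    intro w hw
    have := sp_ident (h 0) (f 0) (h w) (f w)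
    have := pos w hw
    linarith
  have dpos' : ∀ w, ‖w‖ < 1 → ‖f 0 * h w - h 0 * f w‖ <
      ‖(starRingEnd ℂ) (h 0) * h w - (starRingEnd ℂ) (f 0) * f w‖ := fun w hw =>
    lt_of_pow_lt_pow_left₀ 2 (norm_nonneg _) (dpos w hw)
  have dnz : ∀ w, ‖w‖ < 1 → (starRingEnd ℂ) (h 0) * h w - (starRingEnd ℂ) (f 0) * f w ≠ 0 :=
    fun w hw => norm_pos_iff.1 (lt_of_le_of_lt (norm_nonneg _) (dpos' w hw))
  have key := Complex.norm_le_norm_of_mapsTo_ball (R := 1) (z := w)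
    (f := fun w => (f 0 * h w - h 0 * f w) /
      ((starRingEnd ℂ) (h 0) * h w - (starRingEnd ℂ) (f 0) * f w))
    (by
      intro x hx
      have hx' : ‖x‖ < 1 := by simpa using hx
      have a : DifferentiableAt ℂ (fun w => f 0 * h w - h 0 * f w) x := by fun_prop
      have b : DifferentiableAt ℂ (fun w => (starRingEnd ℂ) (h 0) * h w -
          (starRingEnd ℂ) (f 0) * f w) x :=
        ((hh x).const_mul _).sub ((hf x).const_mul _)
      exact (a.fun_div b (dnz x hx')).differentiableWithinAt)
    (by
      intro x hx
      have hx' : ‖x‖ < 1 := by simpa using hx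
      simp only [Metric.mem_closedBall, dist_zero_right, norm_div]
      exact div_le_one_of_le₀ (dpos' x hx').le (norm_nonneg _))
    (by simp [mul_comm]) hw
  rw [norm_div, div_le_iff₀ (norm_pos_iff.2 (dnz w hw))] at key
  have k2 := pow_le_pow_left₀ (norm_nonneg _) key 2
  rw [mul_pow] at k2
  rw [← sp_ident]
  nlinarith

theorem sp_ev {m n : ℕ} {p pt : MvPolynomial (Fin 2) ℂ} (h : IsRIF2 m n p pt)
    (z w : ℂ) (hz : ‖z‖ ≤ 1) (hw : ‖w‖ < 1) :
    ‖(starRingEnd ℂ) (ev p (z, 0)) * ev p (z, w) -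
        (starRingEnd ℂ) (ev pt (z, 0)) * ev pt (z, w)‖ ^ 2 * (1 - ‖w‖ ^ 2) ≤
      (‖ev p (z, 0)‖ ^ 2 - ‖ev pt (z, 0)‖ ^ 2) * (‖ev p (z, w)‖ ^ 2 - ‖ev pt (z, w)‖ ^ 2) := by
  have hcl : z ∈ closure (Metric.ball (0:ℂ) 1) := by
    rw [closure_ball _ one_ne_zero]; simpa using hz
  have hc : ∀ (q : MvPolynomial (Fin 2) ℂ) (w : ℂ), Continuous fun z => ev q (z, w) :=
    fun q w => (ev_cont q).comp (by fun_prop)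
  refine le_on_closure (s := Metric.ball (0:ℂ) 1)
    (f := fun z => ‖(starRingEnd ℂ) (ev p (z, 0)) * ev p (z, w) -
        (starRingEnd ℂ) (ev pt (z, 0)) * ev pt (z, w)‖ ^ 2 * (1 - ‖w‖ ^ 2))
    (g := fun z => (‖ev p (z, 0)‖ ^ 2 - ‖ev pt (z, 0)‖ ^ 2) *
      (‖ev p (z, w)‖ ^ 2 - ‖ev pt (z, w)‖ ^ 2)) ?_ ?_ ?_ hcl
  · intro x hx
    have hx' : ‖x‖ < 1 := by simpa using hx
    exact sp_slice (fun w => ev pt (x, w)) (fun w => ev p (x, w))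
      ((ev_diff pt).comp (by fun_prop)) ((ev_diff p).comp (by fun_prop))
      (fun w hw => pt_lt h (x, w) ⟨hx', hw⟩) w hw
  · have a := hc p 0
    have b := hc p w
    have c := hc pt 0
    have d := hc pt w
    have := Complex.continuous_conj
    refine Continuous.continuousOn ?_
    exact ((((this.comp a).mul b).sub ((this.comp c).mul d)).norm.pow 2).mul_const _
  · have a := hc p 0
    have b := hc p w
    have c := hc pt 0
    have d := hc pt w
    refine Continuous.continuousOn ?_
    fun_prop

/-- Derivative of `r ↦ ‖q(z, r w)‖²` at `r = 1`. -/
theorem ev_nsq_deriv (q : MvPolynomial (Fin 2) ℂ) (z w : ℂ) :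
    HasDerivAt (fun r : ℝ => ‖ev q (z, r * w)‖ ^ 2)
      (2 * ((starRingEnd ℂ) (ev q (z, w)) * (ev (MvPolynomial.pderiv 1 q) (z, w) * w)).re) 1 := by
  have h1 : HasDerivAt (fun r : ℝ => (r : ℂ) * w) w 1 := by
    simpa using (Complex.ofRealCLM.hasDerivAt (x := (1:ℝ))).mul_const w
  have h2 : HasDerivAt (fun r : ℝ => ev q (z, r * w))
      (ev (MvPolynomial.pderiv 1 q) (z, w) * w) 1 := by
    have := ev_hasDeriv q z (((1:ℝ) : ℂ) * w)
    have := this.comp (1:ℝ) h1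
    simpa [Function.comp_def] using this
  have := h2.norm_sq
  convert this using 1
  simp [Complex.inner, mul_comm]

theorem weight_bound {m n : ℕ} {p pt : MvPolynomial (Fin 2) ℂ} (h : IsRIF2 m n p pt)
    (α : ℂ) (hα : ‖α‖ = 1) (z w : ℂ) (hz : ‖z‖ = 1) (hw : ‖w‖ = 1)
    (hpt : ev pt (z, w) = α * ev p (z, w)) (hnz : α * ev p (z, 0) - ev pt (z, 0) ≠ 0) :
    ‖ev p (z, w)‖ / ‖ev (MvPolynomial.pderiv 1 pt) (z, w) -
              α * ev (MvPolynomial.pderiv 1 p) (z, w)‖ ≤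
      (‖ev p (z, 0)‖ ^ 2 - ‖ev pt (z, 0)‖ ^ 2) / ‖α * ev p (z, 0) - ev pt (z, 0)‖ ^ 2 := by
  have hA : 0 ≤ ‖ev p (z, 0)‖ ^ 2 - ‖ev pt (z, 0)‖ ^ 2 := by
    have := pt_le h (z, 0) ⟨hz.le, by simp⟩
    nlinarith [norm_nonneg (ev pt (z, 0))]
  set A := ‖ev p (z, 0)‖ ^ 2 - ‖ev pt (z, 0)‖ ^ 2 with hAdef
  set P := ev p (z, w) with hP
  set D := ev (MvPolynomial.pderiv 1 pt) (z, w) - α * ev (MvPolynomial.pderiv 1 p) (z, w) with hD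
  have hN : 0 < ‖α * ev p (z, 0) - ev pt (z, 0)‖ ^ 2 := by positivity
  rcases eq_or_ne D 0 with h0 | h0
  · rw [h0]; simp only [norm_zero, div_zero]; positivity
  have hDp : 0 < ‖D‖ := norm_pos_iff.2 h0
  rw [div_le_div_iff₀ hDp hN]
  rcases eq_or_ne P 0 with hP0 | hP0
  · rw [hP0]; simp only [norm_zero, zero_mul]; positivity
  have hPp : 0 < ‖P‖ := norm_pos_iff.2 hP0
  -- difference function
  set N : ℝ → ℝ := fun r => ‖(starRingEnd ℂ) (ev p (z, 0)) * ev p (z, r * w) -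
        (starRingEnd ℂ) (ev pt (z, 0)) * ev pt (z, r * w)‖ ^ 2 with hNdef
  have ineq : ∀ᶠ r : ℝ in 𝓝[<] (1:ℝ), N r ≤
      A * ((‖ev p (z, r * w)‖ ^ 2 - ‖ev pt (z, r * w)‖ ^ 2) / (1 - r)) / (1 + r) := by
    have : Set.Ioo (0:ℝ) 1 ∈ 𝓝[<] (1:ℝ) := Ioo_mem_nhdsLT one_pos
    filter_upwards [this] with r hr
    have hrw : ‖(r : ℂ) * w‖ = r := by
      rw [norm_mul, hw, Complex.norm_real, Real.norm_of_nonneg hr.1.le, mul_one]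
    have k := sp_ev h z (r * w) hz.le (by rw [hrw]; exact hr.2)
    rw [hrw] at k
    have e1 : 0 < 1 - r := by linarith [hr.2]
    have e2 : 0 < 1 + r := by linarith [hr.1]
    rw [mul_div_assoc', div_div, le_div_iff₀ (mul_pos e1 e2)]
    calc _ = N r * (1 - r ^ 2) := by ring
      _ ≤ _ := k
  have Ncont : Continuous N := by
    have a : Continuous fun r : ℝ => ev p (z, r * w) := (ev_cont p).comp (by fun_prop)
    have b : Continuous fun r : ℝ => ev pt (z, r * w) := (ev_cont pt).comp (by fun_prop)
    simp only [hNdef]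
    fun_prop
  have lim1 : Tendsto N (𝓝[<] (1:ℝ)) (𝓝 (N 1)) :=
    Ncont.continuousAt.tendsto.mono_left nhdsWithin_le_nhds
  have hder := (ev_nsq_deriv p z w).sub (ev_nsq_deriv pt z w)
  set L := 2 * ((starRingEnd ℂ) (ev p (z, w)) * (ev (MvPolynomial.pderiv 1 p) (z, w) * w)).re -
    2 * ((starRingEnd ℂ) (ev pt (z, w)) * (ev (MvPolynomial.pderiv 1 pt) (z, w) * w)).re with hL
  have hzero : ‖ev p (z, w)‖ ^ 2 - ‖ev pt (z, w)‖ ^ 2 = 0 := by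
    rw [hpt, norm_mul, hα]; ring
  have lim2 : Tendsto (fun r : ℝ => (‖ev p (z, r * w)‖ ^ 2 - ‖ev pt (z, r * w)‖ ^ 2) / (1 - r))
      (𝓝[<] (1:ℝ)) (𝓝 (-L)) := by
    have := (hasDerivAt_iff_tendsto_slope.1 hder).mono_left
      (nhdsWithin_mono (1:ℝ) (fun x (hx : x < 1) => (ne_of_lt hx : x ≠ 1)))
    refine this.neg.congr fun r => ?_
    simp only [slope_def_field, Pi.sub_apply, Complex.ofReal_one, one_mul, hzero, sub_zero]
    rw [← div_neg, neg_sub]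
  have lim3 := ((lim2.const_mul A).div
    (((continuous_const.add continuous_id).continuousAt (x := (1:ℝ))).tendsto.mono_left
      nhdsWithin_le_nhds : Tendsto (fun r : ℝ => 1 + r) (𝓝[<] (1:ℝ)) (𝓝 (1 + 1))) (by norm_num))
  have fin := le_of_tendsto_of_tendsto lim1 lim3 ineq
  have N1 : N 1 = ‖α * ev p (z, 0) - ev pt (z, 0)‖ ^ 2 * ‖P‖ ^ 2 := by
    simp only [hNdef, Complex.ofReal_one, one_mul, hpt, ← hP]
    rw [← mul_pow, ← norm_mul]
    have e : (starRingEnd ℂ) (ev p (z, 0)) * P - (starRingEnd ℂ) (ev pt (z, 0)) * (α * P) =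
        α * ((starRingEnd ℂ) (α * ev p (z, 0) - ev pt (z, 0)) * P) := by
      have : α * (starRingEnd ℂ) α = 1 := by rw [← nsq_c, hα]; simp
      simp only [map_sub, map_mul]
      linear_combination (-(starRingEnd ℂ) (ev p (z, 0)) * P) * this
    rw [e, norm_mul, hα, norm_mul, norm_mul, RCLike.norm_conj, one_mul]
  have Lb : -L ≤ 2 * (‖P‖ * ‖D‖) := by
    have e : -L = 2 * ((starRingEnd ℂ) (α * P) * (D * w)).re := by
      rw [hL, hpt, ← hP, hD]
      have h1 : (starRingEnd ℂ) P * (ev (MvPolynomial.pderiv 1 p) (z, w) * w) =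
          (starRingEnd ℂ) (α * P) * (α * ev (MvPolynomial.pderiv 1 p) (z, w) * w) := by
        have : α * (starRingEnd ℂ) α = 1 := by rw [← nsq_c, hα]; simp
        simp only [map_mul]
        linear_combination (-(starRingEnd ℂ) P * (ev (MvPolynomial.pderiv 1 p) (z, w) * w)) * this
      rw [h1, sub_mul, mul_sub, Complex.sub_re]
      ring
    rw [e]
    have := Complex.re_le_norm ((starRingEnd ℂ) (α * P) * (D * w))
    rw [norm_mul, RCLike.norm_conj, norm_mul, norm_mul, hα, hw, one_mul, mul_one] at this
    linarith
  rw [N1] at fin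
  have f2 : ‖α * ev p (z, 0) - ev pt (z, 0)‖ ^ 2 * ‖P‖ ^ 2 ≤ A * (‖P‖ * ‖D‖) := by
    have := mul_le_mul_of_nonneg_left Lb hA
    simp only [Pi.add_apply, id] at fin
    linarith
  have : (‖P‖ * ‖α * ev p (z, 0) - ev pt (z, 0)‖ ^ 2) * ‖P‖ ≤ (A * ‖D‖) * ‖P‖ := by
    linarith
  exact le_of_mul_le_mul_right this hPp

def uu (p pt : MvPolynomial (Fin 2) ℂ) (α z : ℂ) : ℝ :=
  (‖ev p (z, 0)‖ ^ 2 - ‖ev pt (z, 0)‖ ^ 2) / ‖α * ev p (z, 0) - ev pt (z, 0)‖ ^ 2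

theorem uu_meas (p pt : MvPolynomial (Fin 2) ℂ) (α : ℂ) : Measurable (uu p pt α) := by
  have a : Continuous fun z => ev p (z, 0) := (ev_cont p).comp (by fun_prop)
  have b : Continuous fun z => ev pt (z, 0) := (ev_cont pt).comp (by fun_prop)
  unfold uu
  refine Measurable.div (Continuous.measurable ?_) (Continuous.measurable ?_) <;> fun_prop

theorem uu_contAt (p pt : MvPolynomial (Fin 2) ℂ) (α z : ℂ)
    (hz : α * ev p (z, 0) - ev pt (z, 0) ≠ 0) : ContinuousAt (uu p pt α) z := by
  have a : Continuous fun z => ev p (z, 0) := (ev_cont p).comp (by fun_prop)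
  have b : Continuous fun z => ev pt (z, 0) := (ev_cont pt).comp (by fun_prop)
  unfold uu
  refine ContinuousAt.div (Continuous.continuousAt ?_) (Continuous.continuousAt ?_) ?_
  · fun_prop
  · fun_prop
  · simpa using hz

theorem den_ne {m n : ℕ} {p pt : MvPolynomial (Fin 2) ℂ} (h : IsRIF2 m n p pt)
    (α : ℂ) (hα : ‖α‖ = 1) (z : ℂ) (hz : ‖z‖ < 1) : α * ev p (z, 0) - ev pt (z, 0) ≠ 0 := by
  intro h0
  have := pt_lt h (z, 0) ⟨hz, by simp⟩
  rw [← sub_eq_zero.1 h0, norm_mul, hα, one_mul] at this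
  exact lt_irrefl _ this

theorem uu_eq (p pt : MvPolynomial (Fin 2) ℂ) (α : ℂ) (hα : ‖α‖ = 1) (z : ℂ) :
    uu p pt α z = ((α * ev p (z, 0) + ev pt (z, 0)) / (α * ev p (z, 0) - ev pt (z, 0))).re := by
  have e : ∀ a b : ℂ, ((a + b) / (a - b)).re = (‖a‖ ^ 2 - ‖b‖ ^ 2) / ‖a - b‖ ^ 2 := by
    intro a b
    simp only [← Complex.normSq_eq_norm_sq]
    rw [Complex.div_re, ← add_div]
    congr 1
    simp [Complex.normSq_apply]
    ring
  rw [e, norm_mul, hα, one_mul]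
  rfl

theorem uu_nonneg {m n : ℕ} {p pt : MvPolynomial (Fin 2) ℂ} (h : IsRIF2 m n p pt)
    (α : ℂ) (z : ℂ) (hz : ‖z‖ ≤ 1) : 0 ≤ uu p pt α z := by
  have := pt_le h (z, 0) ⟨hz, by simp⟩
  have : 0 ≤ ‖ev p (z, 0)‖ ^ 2 - ‖ev pt (z, 0)‖ ^ 2 := by
    nlinarith [norm_nonneg (ev pt (z, 0))]
  unfold uu
  positivity

theorem uu_lint {m n : ℕ} {p pt : MvPolynomial (Fin 2) ℂ} (h : IsRIF2 m n p pt)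
    (α : ℂ) (hα : ‖α‖ = 1) (r : ℝ) (hr0 : 0 ≤ r) (hr : r < 1) :
    ∫⁻ θ in Set.Ico 0 (2 * Real.pi), ‖uu p pt α (circleMap 0 r θ)‖ₑ =
      ENNReal.ofReal (2 * Real.pi * uu p pt α 0) := by
  set F : ℂ → ℂ := fun z => (α * ev p (z, 0) + ev pt (z, 0)) / (α * ev p (z, 0) - ev pt (z, 0))
    with hF
  have hFd : ∀ z, ‖z‖ < 1 → DifferentiableAt ℂ F z := by
    intro z hz
    have a : Differentiable ℂ fun z => ev p (z, 0) := (ev_diff p).comp (by fun_prop)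
    have b : Differentiable ℂ fun z => ev pt (z, 0) := (ev_diff pt).comp (by fun_prop)
    exact DifferentiableAt.fun_div (((a z).const_mul α).add (b z))
      (((a z).const_mul α).sub (b z)) (den_ne h α hα z hz)
  have hcm : ∀ θ, ‖circleMap 0 r θ‖ < 1 := by
    intro θ; rw [norm_circleMap_zero, abs_of_nonneg hr0]; exact hr
  have hav : Real.circleAverage F 0 r = F 0 := by
    refine circleAverage_of_differentiable_on_off_countable Set.countable_empty ?_ ?_
    · intro z hz
      refine (hFd z ?_).continuousAt.continuousWithinAt
      rw [abs_of_nonneg hr0] at hz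
      exact lt_of_le_of_lt (by simpa using hz) hr
    · intro z hz
      refine hFd z ?_
      have := hz.1
      rw [abs_of_nonneg hr0] at this
      exact lt_trans (by simpa using this) hr
  have hcont : Continuous fun θ => F (circleMap 0 r θ) := by
    rw [continuous_iff_continuousAt]
    intro θ
    exact ContinuousAt.comp (f := circleMap 0 r) (g := F) (hFd _ (hcm θ)).continuousAt
      (continuous_circleMap 0 r).continuousAt
  have hre : ∫ θ in (0:ℝ)..2 * Real.pi, uu p pt α (circleMap 0 r θ) =
      2 * Real.pi * uu p pt α 0 := by
    have h1 := Complex.reCLM.intervalIntegral_comp_comm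
      (hcont.intervalIntegrable (μ := volume) 0 (2 * Real.pi))
    have h2 : ∫ θ in (0:ℝ)..2 * Real.pi, F (circleMap 0 r θ) = (2 * Real.pi : ℝ) • F 0 := by
      rw [← hav, Real.circleAverage_def, smul_smul, mul_inv_cancel₀ (by positivity), one_smul]
    rw [h2] at h1
    simp only [Complex.reCLM_apply, Complex.smul_re, smul_eq_mul] at h1
    rw [uu_eq p pt α hα 0, ← h1]
    simp only [uu_eq p pt α hα, hF]
  have hcu : Continuous fun θ => uu p pt α (circleMap 0 r θ) := by
    have := Complex.continuous_re.comp hcont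
    simp only [uu_eq p pt α hα]
    exact this
  rw [← hre, intervalIntegral.integral_of_le (by positivity), ← integral_Ico_eq_integral_Ioc,
    ofReal_integral_eq_lintegral_ofReal]
  · refine lintegral_congr fun θ => ?_
    rw [Real.enorm_of_nonneg (uu_nonneg h α _ (hcm θ).le)]
  · exact (hcu.integrableOn_Icc).mono_set Set.Ico_subset_Icc_self
  · exact Filter.Eventually.of_forall fun θ => uu_nonneg h α _ (hcm θ).le

theorem den_ae {m n : ℕ} {p pt : MvPolynomial (Fin 2) ℂ} (h : IsRIF2 m n p pt)
    (α : ℂ) (hα : ‖α‖ = 1) :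
    ∀ᵐ θ : ℝ ∂(volume.restrict (Set.Ico 0 (2 * Real.pi))),
      α * ev p (circleMap 0 1 θ, 0) - ev pt (circleMap 0 1 θ, 0) ≠ 0 := by
  set q : Polynomial ℂ := MvPolynomial.aeval ![Polynomial.X, 0] (MvPolynomial.C α * p - pt) with hq
  have hev : ∀ z, q.eval z = α * ev p (z, 0) - ev pt (z, 0) := by
    intro z
    have : ∀ s : MvPolynomial (Fin 2) ℂ,
        (MvPolynomial.aeval ![Polynomial.X, 0] s : Polynomial ℂ).eval z = ev s (z, 0) := by
      intro s
      unfold ev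
      induction s using MvPolynomial.induction_on with
      | C a => simp
      | add p q hp hq => simp [hp, hq]
      | mul_X p i hp =>
        rw [map_mul, map_mul, Polynomial.eval_mul, hp]
        fin_cases i <;> simp
    rw [hq, this]
    simp [ev]
  have q0 : q ≠ 0 := by
    intro h0
    have := den_ne h α hα 0 (by simp)
    rw [← hev, h0] at this
    simp at this
  rw [ae_restrict_iff' measurableSet_Ico]
  have hfin : (Set.Ico 0 (2 * Real.pi) ∩ (circleMap 0 1) ⁻¹' {z | q.IsRoot z}).Finite := by
    have hinj : Set.InjOn (circleMap 0 1) (Set.Ico 0 (2 * Real.pi)) := by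
      intro a ha b hb hab
      refine Circle.exp_injOn_Ico (a := 0) (b := 2 * Real.pi) (by simp) ha hb ?_
      apply Subtype.ext
      simpa [circleMap] using hab
    exact Set.Finite.of_injOn (t := {z | q.IsRoot z}) (fun x hx => hx.2)
      (hinj.mono Set.inter_subset_left) (Polynomial.finite_setOf_isRoot q0)
  have := hfin.measure_zero volume
  rw [ae_iff]
  refine measure_mono_null ?_ this
  intro x hx
  simp only [Set.mem_setOf_eq, Classical.not_imp, not_not] at hx
  refine ⟨hx.1, ?_⟩
  change q.eval _ = 0
  rw [hev]; exact hx.2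

theorem uu_int {m n : ℕ} {p pt : MvPolynomial (Fin 2) ℂ} (h : IsRIF2 m n p pt)
    (α : ℂ) (hα : ‖α‖ = 1) :
    Integrable (fun θ => uu p pt α (circleMap 0 1 θ))
      (volume.restrict (Set.Ico 0 (2 * Real.pi))) := by
  have hr : ∀ k : ℕ, (0:ℝ) ≤ 1 - 1 / ((k:ℝ) + 1) ∧ (1:ℝ) - 1 / ((k:ℝ) + 1) < 1 := by
    intro k
    have h1 : (0:ℝ) < 1 / ((k:ℝ) + 1) := by positivity
    have h2 : 1 / ((k:ℝ) + 1) ≤ 1 := by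
      rw [div_le_one (by positivity)]; linarith [Nat.cast_nonneg (α := ℝ) k]
    constructor <;> linarith
  refine integrable_of_tendsto
    (G := fun k θ => uu p pt α (circleMap 0 (1 - 1 / ((k:ℝ) + 1)) θ)) ?_ ?_ ?_
  · filter_upwards [den_ae h α hα] with θ hθ
    have h1 : Tendsto (fun k : ℕ => (1:ℝ) - 1 / ((k:ℝ) + 1)) atTop (𝓝 1) := by
      simpa using tendsto_one_div_add_atTop_nhds_zero_nat.const_sub (1:ℝ)
    have h2 : Continuous fun r : ℝ => circleMap 0 r θ := by unfold circleMap; fun_prop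
    exact ((uu_contAt p pt α _ hθ).tendsto.comp (h2.tendsto 1)).comp h1
  · intro k
    exact ((uu_meas p pt α).comp (continuous_circleMap _ _).measurable).aestronglyMeasurable
  · simp only [fun k : ℕ => uu_lint h α hα _ (hr k).1 (hr k).2]
    simp

theorem level_eq {p pt : MvPolynomial (Fin 2) ℂ} {α : ℂ} {z : ℂ × ℂ}
    (hst : ∀ z ∈ bidisk, ev p z ≠ 0)
    (hz : z ∈ levelSet2 p pt α) : ev pt z = α * ev p z := by
  have hcl : IsClosed {z : ℂ × ℂ | ev pt z = α * ev p z} :=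
    isClosed_eq (ev_cont pt) ((ev_cont p).const_mul α)
  refine closure_minimal ?_ hcl hz
  rintro ζ ⟨⟨h1, h2⟩, ht⟩
  have c : ∀ q : MvPolynomial (Fin 2) ℂ,
      Tendsto (fun r : ℝ => ev q ((r : ℂ) * ζ.1, (r : ℂ) * ζ.2)) (𝓝[<] (1 : ℝ)) (𝓝 (ev q ζ)) := by
    intro q
    have : Continuous (fun r : ℝ => ev q ((r : ℂ) * ζ.1, (r : ℂ) * ζ.2)) :=
      (ev_cont q).comp (by fun_prop)
    simpa using (this.tendsto 1).mono_left nhdsWithin_le_nhds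
  refine tendsto_nhds_unique (c pt) ((ht.mul (c p)).congr' ?_)
  have : Set.Ioo (0:ℝ) 1 ∈ 𝓝[<] (1:ℝ) := Ioo_mem_nhdsLT one_pos
  filter_upwards [this] with r hr
  unfold rif
  refine div_mul_cancel₀ _ (hst _ ⟨?_, ?_⟩)
  · simp [h1, abs_of_pos hr.1, hr.2]
  · simp [h2, abs_of_pos hr.1, hr.2]

theorem formula_pt {p pt : MvPolynomial (Fin 2) ℂ} {α : ℂ} {z : ℂ × ℂ}
    (hz : ev pt z = α * ev p z) : ‖dphi2 p pt z‖⁻¹ = ‖ev p z‖ /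
            ‖ev (MvPolynomial.pderiv 1 pt) z - α * ev (MvPolynomial.pderiv 1 p) z‖ := by
  rcases eq_or_ne (ev p z) 0 with h0 | h0
  · simp [dphi2, h0]
  · have : dphi2 p pt z = (ev (MvPolynomial.pderiv 1 pt) z -
        α * ev (MvPolynomial.pderiv 1 p) z) / ev p z := by
      rw [dphi2, hz]; field_simp
    rw [this, norm_div, inv_div]

theorem graph_meas (g : ℂ → ℂ) (τ : ℂ) (hg : ∀ θ : ℝ, Complex.exp ((θ : ℂ) * Complex.I) ≠ τ →
      AnalyticAt ℝ (fun t : ℝ => g (Complex.exp ((t : ℂ) * Complex.I))) θ) :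
    Measurable (fun t : ℝ => g (Complex.exp ((t : ℂ) * Complex.I))) := by
  classical
  have hc : Continuous fun t : ℝ => Complex.exp ((t : ℂ) * Complex.I) := by fun_prop
  set U : Set ℝ := {t : ℝ | Complex.exp ((t : ℂ) * Complex.I) ≠ τ} with hU
  have hUo : IsOpen U := isOpen_ne_fun hc continuous_const
  have e : (fun t : ℝ => g (Complex.exp ((t : ℂ) * Complex.I))) =
      U.piecewise (fun t : ℝ => g (Complex.exp ((t : ℂ) * Complex.I))) (fun _ => g τ) := by
    ext t
    by_cases ht : t ∈ U
    · rw [Set.piecewise_eq_of_mem _ _ _ ht]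
    · rw [Set.piecewise_eq_of_notMem _ _ _ ht]
      have : Complex.exp ((t : ℂ) * Complex.I) = τ := not_not.1 ht
      rw [this]
  rw [e]
  refine ContinuousOn.measurable_piecewise ?_ continuousOn_const hUo.measurableSet
  intro t ht
  exact (hg t ht).continuousAt.continuousWithinAt

/-- Let `φ = p̃/p` be a bidegree `(m,n)` RIF on `𝔻²` and let `α ∈ 𝕋`
be generic for `φ`. Then each Clark weight `W_j^α(ζ) = |∂φ/∂z₂(ζ, g_j^α(ζ))|⁻¹` belongs
to `L¹(𝕋, m)` and satisfies
`W_j^α(ζ) = |p(ζ, g_j^α(ζ))| / |∂p̃/∂z₂(ζ, g_j^α(ζ)) − α ∂p/∂z₂(ζ, g_j^α(ζ))|`. -/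
theorem clark_weight_integrable_and_formula
    (m n : ℕ) (p pt : MvPolynomial (Fin 2) ℂ) (hRIF : IsRIF2 m n p pt)
    (α : ℂ) (hα : ‖α‖ = 1) (hgen : IsGenericValue p pt α)
    (g : Fin n → ℂ → ℂ) (hg : IsGraphFamily n g)
    (hparam : levelSet2 p pt α = graphUnion n g) :
    ∀ j : Fin n,
      Integrable (fun ζ : ℂ => ‖dphi2 p pt (ζ, g j ζ)‖⁻¹) mCircle ∧
      ∀ ζ : ℂ, ‖ζ‖ = 1 →
        ‖dphi2 p pt (ζ, g j ζ)‖⁻¹ =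
          ‖ev p (ζ, g j ζ)‖ /
            ‖ev (MvPolynomial.pderiv 1 pt) (ζ, g j ζ) -
              α * ev (MvPolynomial.pderiv 1 p) (ζ, g j ζ)‖ := by
  intro j
  have hlev : ∀ ζ : ℂ, ‖ζ‖ = 1 → ev pt (ζ, g j ζ) = α * ev p (ζ, g j ζ) := by
    intro ζ hζ
    refine level_eq hRIF.stable ?_
    rw [hparam]
    exact Set.mem_iUnion.2 ⟨j, hζ, rfl⟩
  refine ⟨?_, fun ζ hζ => formula_pt (hlev ζ hζ)⟩
  obtain ⟨hg1, τ, hτ, hga⟩ := hg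
  have hm := graph_meas (g j) τ (hga j)
  set e : ℝ → ℂ := fun θ : ℝ => Complex.exp ((θ : ℂ) * Complex.I) with he
  have hec : Continuous e := by simp only [he]; fun_prop
  have hen : ∀ θ, ‖e θ‖ = 1 := fun θ => Complex.norm_exp_ofReal_mul_I θ
  have hcm : ∀ θ, circleMap 0 1 θ = e θ := by intro θ; simp [circleMap, he]
  set H : ℂ → ℂ := fun ζ => g j (e ζ.arg) with hH
  have hHm : Measurable H := hm.comp Complex.measurable_arg
  have hHe : ∀ ζ : ℂ, ‖ζ‖ = 1 → H ζ = g j ζ := by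
    intro ζ hζ
    have := Complex.norm_mul_exp_arg_mul_I ζ
    rw [hζ, Complex.ofReal_one, one_mul] at this
    simp only [hH, he, this]
  have evm : ∀ q : MvPolynomial (Fin 2) ℂ, Measurable fun ζ => ev q (ζ, H ζ) := fun q =>
    (ev_cont q).measurable.comp (measurable_id.prodMk hHm)
  have Wm : Measurable fun ζ => ‖dphi2 p pt (ζ, H ζ)‖⁻¹ := by
    have a := evm p
    have b := evm pt
    have c := evm (MvPolynomial.pderiv 1 p)
    have d := evm (MvPolynomial.pderiv 1 pt)
    unfold dphi2
    exact (((d.mul a).sub (b.mul c)).div (a.pow_const 2)).norm.inv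
  unfold mCircle
  refine Integrable.smul_measure ?_ (by
    rw [ENNReal.inv_ne_top]; exact (ENNReal.ofReal_pos.2 (by positivity)).ne')
  have hWi : Integrable (fun ζ => ‖dphi2 p pt (ζ, H ζ)‖⁻¹)
      (Measure.map e (volume.restrict (Set.Ico 0 (2 * Real.pi)))) := by
    rw [integrable_map_measure Wm.aestronglyMeasurable hec.measurable.aemeasurable]
    refine (uu_int hRIF α hα).mono' (Wm.comp hec.measurable).aestronglyMeasurable ?_
    filter_upwards [den_ae hRIF α hα] with θ hθ
    rw [hcm] at hθ ⊢
    simp only [Function.comp]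
    rw [hHe _ (hen θ), Real.norm_of_nonneg (by positivity), formula_pt (hlev _ (hen θ))]
    exact weight_bound hRIF α hα (e θ) (g j (e θ)) (hen θ) (hg1 j _ (hen θ)) (hlev _ (hen θ)) hθ
  refine hWi.congr ?_
  have : ∀ᵐ ζ ∂(Measure.map e (volume.restrict (Set.Ico 0 (2 * Real.pi)))), ‖ζ‖ = 1 := by
    rw [ae_map_iff hec.measurable.aemeasurable
      (isClosed_eq continuous_norm continuous_const).measurableSet]
    exact Filter.Eventually.of_forall hen
  filter_upwards [this] with ζ hζ
  rw [hHe ζ hζ]
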